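/- Let (X,d) be a separable metric space, μ a positive Borel measure on X, and q a premeasure on closed balls such that q(B_r(x)) ≤ C μ(B_r(x)) for some C ≥ 1, all x ∈ X and all 0 < r < r₀. Then for every countable family (U_k)_{k∈ℕ} of open subsets of X with Σ_k μ(U_k) < +∞, one has ĥμ^q(∪_k U_k) ≤ Σ_k ĥμ^q(U_k), where ĥμ^q is the packing construction associated with q. In particular, if μ is a finite measure then ĥμ^q is an outer measure on X. -/

import Mathlib

open MeasureTheory Metric Set Filter Topology ENNReal Bornology

/-- A packing of the open set `U` of order `δ`: a countable family of pairwise disjoint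
closed balls, each of positive radius at most `δ` and contained in `U`, encoded as a
countable set of (center, radius) pairs. -/
def IsPackingOf {X : Type*} [MetricSpace X] (U : Set X) (δ : ℝ) (P : Set (X × ℝ)) : Prop :=
  P.Countable ∧ (∀ p ∈ P, 0 < p.2 ∧ p.2 ≤ δ ∧ Metric.closedBall p.1 p.2 ⊆ U) ∧
  P.Pairwise fun p p' => Disjoint (Metric.closedBall p.1 p.2) (Metric.closedBall p'.1 p'.2)

/-- `ĥμ^q_δ(U)`: supremum of `∑_{B ∈ ℱ} q(B)` over packings `ℱ` of `U` of order `δ`. -/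
noncomputable def packPre {X : Type*} [MetricSpace X] (q : X → ℝ → ℝ≥0∞) (δ : ℝ)
    (U : Set X) : ℝ≥0∞ :=
  ⨆ (P : Set (X × ℝ)) (_ : IsPackingOf U δ P), ∑' p : P, q p.1.1 p.1.2

/-- `ĥμ^q(U) = inf_{δ>0} ĥμ^q_δ(U)` for `U` open. -/
noncomputable def packOpen {X : Type*} [MetricSpace X] (q : X → ℝ → ℝ≥0∞)
    (U : Set X) : ℝ≥0∞ :=
  ⨅ (δ : ℝ) (_ : 0 < δ), packPre q δ U

/-- The packing construction extended to arbitrary sets: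
`ĥμ^q(A) = inf { ĥμ^q(U) : A ⊆ U, U open }`. -/
noncomputable def packM {X : Type*} [MetricSpace X] (q : X → ℝ → ℝ≥0∞)
    (A : Set X) : ℝ≥0∞ :=
  ⨅ (U : Set X) (_ : IsOpen U) (_ : A ⊆ U), packOpen q U

section Packing

variable {X : Type*} [MetricSpace X] {q : X → ℝ → ℝ≥0∞}

theorem IsPackingOf.subset {U V : Set X} {δ : ℝ} {P Q : Set (X × ℝ)} (hP : IsPackingOf U δ P)
    (hQP : Q ⊆ P) (hQ : ∀ p ∈ Q, Metric.closedBall p.1 p.2 ⊆ V) : IsPackingOf V δ Q :=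
  ⟨hP.1.mono hQP, fun p hp => ⟨(hP.2.1 p (hQP hp)).1, (hP.2.1 p (hQP hp)).2.1, hQ p hp⟩,
    hP.2.2.mono hQP⟩

theorem packPre_mono_order (q : X → ℝ → ℝ≥0∞) (U : Set X) :
    Monotone fun δ => packPre q δ U := by
  intro δ δ' h
  refine iSup_mono fun P => iSup_le fun hP => ?_
  exact le_iSup_of_le (f := fun _ : IsPackingOf U δ' P => ∑' p : P, q p.1.1 p.1.2)
    ⟨hP.1, fun p hp => ⟨(hP.2.1 p hp).1, (hP.2.1 p hp).2.1.trans h, (hP.2.1 p hp).2.2⟩, hP.2.2⟩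
    le_rfl

theorem tendsto_packPre (q : X → ℝ → ℝ≥0∞) (U : Set X) :
    Tendsto (fun δ => packPre q δ U) (𝓝[>] 0) (𝓝 (packOpen q U)) := by
  have h := (packPre_mono_order q U).tendsto_nhdsGT 0
  rwa [sInf_image] at h

theorem packPre_empty (q : X → ℝ → ℝ≥0∞) (δ : ℝ) : packPre q δ ∅ = 0 := by
  refine le_antisymm (iSup₂_le fun P hP => ?_) zero_le
  have hP' : P = ∅ := eq_empty_of_forall_notMem fun p hp =>
    (hP.2.1 p hp).2.2 (mem_closedBall_self (hP.2.1 p hp).1.le)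
  subst hP'
  simp

theorem packOpen_empty (q : X → ℝ → ℝ≥0∞) : packOpen q ∅ = 0 := by
  refine le_antisymm (iInf₂_le_of_le 1 one_pos ?_) zero_le
  rw [packPre_empty]

theorem packM_mono (q : X → ℝ → ℝ≥0∞) {A B : Set X} (h : A ⊆ B) :
    packM q A ≤ packM q B :=
  iInf_mono fun _ => iInf_mono fun _ => le_iInf fun hB => iInf_le _ (h.trans hB)

theorem packM_le_packOpen (q : X → ℝ → ℝ≥0∞) {A U : Set X} (hU : IsOpen U) (h : A ⊆ U) :
    packM q A ≤ packOpen q U :=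
  iInf_le_of_le U (iInf₂_le hU h)

theorem closedBall_subset_cthickening_compl {U : Set X} {x : X} {r δ : ℝ} (hr : r ≤ δ)
    (h : ¬ Metric.closedBall x r ⊆ U) :
    Metric.closedBall x r ⊆ cthickening (2 * δ) Uᶜ := by
  obtain ⟨y, hy, hyU⟩ := not_subset.1 h
  intro z hz
  refine mem_cthickening_of_dist_le z y _ _ hyU ?_
  have := dist_triangle_right z y x
  rw [mem_closedBall] at hy hz
  linarith

variable [MeasurableSpace X] [BorelSpace X] {μ : Measure X} {C r₀ : ℝ}

theorem IsPackingOf.tsum_le_measure {T : Set X} {δ : ℝ} {P : Set (X × ℝ)}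
    (hP : IsPackingOf T δ P) (hδ : δ < r₀)
    (hq : ∀ (x : X) (r : ℝ), 0 < r → r < r₀ →
      q x r ≤ ENNReal.ofReal C * μ (Metric.closedBall x r)) :
    ∑' p : P, q p.1.1 p.1.2 ≤ ENNReal.ofReal C * μ T :=
  calc ∑' p : P, q p.1.1 p.1.2
      ≤ ∑' p : P, ENNReal.ofReal C * μ (Metric.closedBall p.1.1 p.1.2) :=
        ENNReal.tsum_le_tsum fun p =>
          hq _ _ (hP.2.1 p p.2).1 ((hP.2.1 p p.2).2.1.trans_lt hδ)
    _ = ENNReal.ofReal C * μ (⋃ p ∈ P, Metric.closedBall p.1 p.2) := by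
        rw [ENNReal.tsum_mul_left,
          measure_biUnion hP.1 hP.2.2 fun p _ => isClosed_closedBall.measurableSet]
    _ ≤ ENNReal.ofReal C * μ T := by
        gcongr
        exact iUnion₂_subset fun p hp => (hP.2.1 p hp).2.2

theorem packPre_le_sum_add {W : Set X} (U : ℕ → Set X) (N : ℕ) {δ : ℝ} (hδ : δ < r₀)
    (hq : ∀ (x : X) (r : ℝ), 0 < r → r < r₀ →
      q x r ≤ ENNReal.ofReal C * μ (Metric.closedBall x r)) :
    packPre q δ W ≤ ∑ k ∈ Finset.range N, packPre q δ (U k) +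
      ENNReal.ofReal C * μ (W ∩ ⋂ k ∈ Finset.range N, cthickening (2 * δ) (U k)ᶜ) := by
  refine iSup₂_le fun P hP => ?_
  let S : ℕ → Set (X × ℝ) := fun k => {p ∈ P | Metric.closedBall p.1 p.2 ⊆ U k}
  let R : Set (X × ℝ) := {p ∈ P | ∀ k ∈ Finset.range N, ¬ Metric.closedBall p.1 p.2 ⊆ U k}
  have hcover : P ⊆ (⋃ k ∈ Finset.range N, S k) ∪ R := by
    intro p hp
    by_cases h : ∃ k ∈ Finset.range N, Metric.closedBall p.1 p.2 ⊆ U k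
    · obtain ⟨k, hk, hpk⟩ := h
      exact Or.inl (mem_iUnion₂.2 ⟨k, hk, hp, hpk⟩)
    · push Not at h
      exact Or.inr ⟨hp, h⟩
  let f : X × ℝ → ℝ≥0∞ := fun p => q p.1 p.2
  calc ∑' p : P, f p
      ≤ ∑' p : ↥((⋃ k ∈ Finset.range N, S k) ∪ R), f p := ENNReal.tsum_mono_subtype f hcover
    _ ≤ ∑' p : ↥(⋃ k ∈ Finset.range N, S k), f p + ∑' p : R, f p :=
        ENNReal.tsum_union_le f _ _
    _ ≤ ∑ k ∈ Finset.range N, ∑' p : S k, f p + ∑' p : R, f p := by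
        gcongr
        exact ENNReal.tsum_biUnion_le f _ S
    _ ≤ _ := by
        gcongr with k
        · exact le_iSup₂_of_le (S k) (hP.subset (sep_subset _ _) fun p hp => hp.2) le_rfl
        · refine IsPackingOf.tsum_le_measure (hP.subset (sep_subset _ _) fun p hp => ?_) hδ hq
          exact subset_inter (hP.2.1 p hp.1).2.2 (subset_iInter₂ fun k hk =>
            closedBall_subset_cthickening_compl (hP.2.1 p hp.1).2.1 (hp.2 k hk))

theorem tendsto_measure_inter_cthickening {W : Set X} (hW : MeasurableSet W) (hμ : μ W ≠ ⊤)
    {U : ℕ → Set X} (hU : ∀ k, IsOpen (U k)) (N : ℕ) :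
    Tendsto (fun δ : ℝ => μ (W ∩ ⋂ k ∈ Finset.range N, cthickening (2 * δ) (U k)ᶜ)) (𝓝[>] 0)
      (𝓝 (μ (W \ ⋃ k ∈ Finset.range N, U k))) := by
  have hset : W \ ⋃ k ∈ Finset.range N, U k =
      ⋂ δ > (0 : ℝ), W ∩ ⋂ k ∈ Finset.range N, cthickening (2 * δ) (U k)ᶜ := by
    ext x
    simp only [Set.mem_sdiff, mem_iUnion, mem_iInter, mem_inter_iff, not_exists]
    constructor
    · exact fun h δ hδ => ⟨h.1, fun k hk => self_subset_cthickening _ (h.2 k hk)⟩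
    · refine fun h => ⟨(h 1 one_pos).1, fun k hk => ?_⟩
      have hx : x ∈ closure (U k)ᶜ := by
        rw [closure_eq_iInter_cthickening]
        refine mem_iInter₂.2 fun ε hε => ?_
        have := (h (ε / 2) (half_pos hε)).2 k hk
        rwa [mul_div_cancel₀ _ two_ne_zero] at this
      rwa [(hU k).isClosed_compl.closure_eq] at hx
  rw [hset]
  refine tendsto_measure_biInter_gt (fun δ _ => (hW.inter ?_).nullMeasurableSet) ?_ ?_
  · exact Finset.measurableSet_biInter _ fun k _ => isClosed_cthickening.measurableSet
  · intro i j _ hij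
    exact inter_subset_inter_right _ (iInter₂_mono fun k _ =>
      cthickening_mono (by linarith) _)
  · exact ⟨1, one_pos, measure_ne_top_of_subset inter_subset_left hμ⟩

theorem packOpen_iUnion_le (hr₀ : 0 < r₀)
    (hq : ∀ (x : X) (r : ℝ), 0 < r → r < r₀ →
      q x r ≤ ENNReal.ofReal C * μ (Metric.closedBall x r))
    {U : ℕ → Set X} (hU : ∀ k, IsOpen (U k)) (hμ : μ (⋃ k, U k) ≠ ⊤) :
    packOpen q (⋃ k, U k) ≤ ∑' k, packOpen q (U k) := by
  set W := ⋃ k, U k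
  have hW : MeasurableSet W := (isOpen_iUnion hU).measurableSet
  have hfin : ∀ N, packOpen q W ≤ ∑ k ∈ Finset.range N, packOpen q (U k) +
      ENNReal.ofReal C * μ (W \ ⋃ k ∈ Finset.range N, U k) := by
    intro N
    refine le_of_tendsto_of_tendsto (tendsto_packPre q W)
      ((tendsto_finsetSum _ fun k _ => tendsto_packPre q (U k)).add
        (ENNReal.Tendsto.const_mul (tendsto_measure_inter_cthickening hW hμ hU N)
          (Or.inr ENNReal.ofReal_ne_top))) ?_
    filter_upwards [Ioo_mem_nhdsGT hr₀] with δ hδ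
    exact packPre_le_sum_add U N hδ.2 hq
  have hrest : Tendsto (fun N : ℕ => μ (W \ ⋃ k ∈ Finset.range N, U k)) atTop (𝓝 0) := by
    have hempty : ⋂ N : ℕ, (W \ ⋃ k ∈ Finset.range N, U k) = ∅ := by
      refine eq_empty_of_forall_notMem fun x hx => ?_
      obtain ⟨k, hk⟩ := mem_iUnion.1 (mem_iInter.1 hx 0).1
      exact (mem_iInter.1 hx (k + 1)).2 (mem_iUnion₂.2 ⟨k, Finset.self_mem_range_succ k, hk⟩)
    rw [← measure_empty (μ := μ), ← hempty]
    refine tendsto_measure_iInter_atTop (fun N => (hW.diff ?_).nullMeasurableSet) ?_ ?_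
    · exact (isOpen_biUnion fun k _ => hU k).measurableSet
    · intro M N hMN
      exact sdiff_subset_sdiff_right (biUnion_subset_biUnion_left (Finset.range_mono hMN))
    · exact ⟨0, measure_ne_top_of_subset sdiff_subset hμ⟩
  have hlim := ENNReal.summable.tendsto_sum_tsum_nat (f := fun k => packOpen q (U k)) |>.add
    (ENNReal.Tendsto.const_mul hrest (Or.inr (ENNReal.ofReal_ne_top (r := C))))
  rw [mul_zero, add_zero] at hlim
  exact ge_of_tendsto' hlim hfin

theorem packM_iUnion_le [IsFiniteMeasure μ] (hr₀ : 0 < r₀)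
    (hq : ∀ (x : X) (r : ℝ), 0 < r → r < r₀ →
      q x r ≤ ENNReal.ofReal C * μ (Metric.closedBall x r))
    (A : ℕ → Set X) : packM q (⋃ n, A n) ≤ ∑' n, packM q (A n) := by
  refine ENNReal.le_of_forall_pos_le_add fun ε hε hlt => ?_
  obtain ⟨ε', hε', hsum⟩ := ENNReal.exists_pos_sum_of_countable' (ENNReal.coe_pos.2 hε).ne' ℕ
  have hex : ∀ n, ∃ U : Set X, IsOpen U ∧ A n ⊆ U ∧ packOpen q U < packM q (A n) + ε' n := by
    intro n
    have h : packM q (A n) < packM q (A n) + ε' n :=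
      ENNReal.lt_add_right (ENNReal.ne_top_of_tsum_ne_top hlt.ne n) (hε' n).ne'
    conv_lhs at h => rw [packM]
    simpa only [iInf_lt_iff, exists_prop] using h
  choose U hU hAU hlt' using hex
  calc packM q (⋃ n, A n)
      ≤ packOpen q (⋃ n, U n) := packM_le_packOpen q (isOpen_iUnion hU) (iUnion_mono hAU)
    _ ≤ ∑' n, packOpen q (U n) := packOpen_iUnion_le hr₀ hq hU (measure_ne_top μ _)
    _ ≤ ∑' n, (packM q (A n) + ε' n) := ENNReal.tsum_le_tsum fun n => (hlt' n).le
    _ = ∑' n, packM q (A n) + ∑' n, ε' n := ENNReal.tsum_add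
    _ ≤ ∑' n, packM q (A n) + ε := by gcongr

end Packing

/-- in a separable metric space, if `q(B_r(x)) ≤ C μ(B_r(x))` for `0 < r < r₀`,
then the packing construction is countably sub-additive on countable families of open sets
with `∑ μ(U_k) < ∞`; in particular if `μ` is finite then `ĥμ^q` is an outer measure. -/
theorem stmt7 {X : Type*} [MetricSpace X] [MeasurableSpace X] [BorelSpace X]
    [TopologicalSpace.SeparableSpace X]
    (μ : Measure X) (q : X → ℝ → ℝ≥0∞) (C r₀ : ℝ) (hC : 1 ≤ C) (hr₀ : 0 < r₀)
    (hq : ∀ (x : X) (r : ℝ), 0 < r → r < r₀ →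
      q x r ≤ ENNReal.ofReal C * μ (Metric.closedBall x r)) :
    (∀ U : ℕ → Set X, (∀ k, IsOpen (U k)) → (∑' k, μ (U k)) < ⊤ →
      packOpen q (⋃ k, U k) ≤ ∑' k, packOpen q (U k)) ∧
    (μ Set.univ < ⊤ →
      packM q (∅ : Set X) = 0 ∧
      (∀ A B : Set X, A ⊆ B → packM q A ≤ packM q B) ∧
      (∀ A : ℕ → Set X, packM q (⋃ n, A n) ≤ ∑' n, packM q (A n))) := by
  refine ⟨fun U hU hsum => ?_, fun hμ => ⟨?_, fun A B => packM_mono q, ?_⟩⟩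
  · exact packOpen_iUnion_le hr₀ hq hU ((measure_iUnion_le U).trans_lt hsum).ne
  · exact le_antisymm ((packM_le_packOpen q isOpen_empty subset_rfl).trans_eq (packOpen_empty q))
      zero_le
  · have : IsFiniteMeasure μ := ⟨hμ⟩
    exact packM_iUnion_le hr₀ hq
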